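/- Let A ⊆ H be an affine commutative-by-finite Hopf algebra with A semiprime or central in H, or H pointed, over a field k of characteristic 0. Then the kernel of the restriction of ι° to the tangential component equals (H̄*)⁺W(H°); that is, ker(ι°|_{W(H°)}) = (H̄*)⁺W(H°), so W(H°)/(H̄*)⁺W(H°) ≅ U(𝔤). -/

import Mathlib

open TensorProduct LinearMap Coalgebra

namespace Paper

noncomputable section

variable (k : Type) [Field k]

section Coalg

variable {C : Type} [AddCommMonoid C] [Module k C] [Coalgebra k C]

/-- Convolution product on the linear dual of a coalgebra. -/
noncomputable def conv (f g : Module.Dual k C) : Module.Dual k C :=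
  (TensorProduct.lid k k).toLinearMap ∘ₗ TensorProduct.map f g ∘ₗ Coalgebra.comul

/-- The unit of the convolution algebra on the dual: the counit. -/
noncomputable def convOne : Module.Dual k C := Coalgebra.counit

/-- Iterated convolution power. -/
noncomputable def convPow (f : Module.Dual k C) : ℕ → Module.Dual k C
  | 0 => convOne k
  | n + 1 => conv k f (convPow f n)

end Coalg

/-- The finite dual of an algebra: functionals vanishing on a two-sided ideal
of finite codimension. -/
def finDual (H : Type) [Ring H] [Algebra k H] : Set (Module.Dual k H) :=
  {f | ∃ I : Submodule k H, (∀ (h : H), ∀ x ∈ I, h * x ∈ I ∧ x * h ∈ I) ∧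
    I ≤ LinearMap.ker f ∧ FiniteDimensional k (H ⧸ I)}

section Hopf

variable (H : Type) [Ring H] [HopfAlgebra k H]

/-- Left adjoint action `(ad_ℓ h)(a) = Σ h₁ a S(h₂)`. -/
noncomputable def adl (h a : H) : H :=
  TensorProduct.lift (((LinearMap.mul k H).comp (LinearMap.mulRight k a)).compl₂
    (HopfAlgebra.antipode (R := k))) (Coalgebra.comul h)

/-- Right adjoint action `(ad_r h)(a) = Σ S(h₁) a h₂`. -/
noncomputable def adr (h a : H) : H :=
  TensorProduct.lift ((LinearMap.mul k H).comp ((LinearMap.mulRight k a) ∘ₗ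
    (HopfAlgebra.antipode (R := k)))) (Coalgebra.comul h)

/-- Left adjoint action on the dual: `(ad_ℓ φ)(f) = Σ φ₁ f S°(φ₂)`, i.e.
`h ↦ Σ φ(h₁ S(h₃)) f(h₂)`. -/
noncomputable def adld (φ f : Module.Dual k H) : Module.Dual k H :=
  (TensorProduct.lid k k).toLinearMap ∘ₗ
    TensorProduct.map (φ ∘ₗ LinearMap.mul' k H ∘ₗ
      (HopfAlgebra.antipode (R := k)).lTensor H) f ∘ₗ
    (TensorProduct.assoc k H H H).symm.toLinearMap ∘ₗ
    ((TensorProduct.comm k H H).toLinearMap.lTensor H) ∘ₗ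
    ((Coalgebra.comul (R := k) (A := H)).lTensor H) ∘ₗ
    Coalgebra.comul

/-- Right adjoint action on the dual: `(ad_r φ)(f) = Σ S°(φ₁) f φ₂`, i.e.
`h ↦ Σ φ(S(h₁) h₃) f(h₂)`. -/
noncomputable def adrd (φ f : Module.Dual k H) : Module.Dual k H :=
  (TensorProduct.lid k k).toLinearMap ∘ₗ
    TensorProduct.map (φ ∘ₗ LinearMap.mul' k H ∘ₗ
      (HopfAlgebra.antipode (R := k)).rTensor H) f ∘ₗ
    (TensorProduct.assoc k H H H).symm.toLinearMap ∘ₗ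
    ((TensorProduct.comm k H H).toLinearMap.lTensor H) ∘ₗ
    ((Coalgebra.comul (R := k) (A := H)).lTensor H) ∘ₗ
    Coalgebra.comul

/-- A submodule is a subcoalgebra if its image under `comul` lies in `V ⊗ V`. -/
def IsSubcoalgebra (V : Submodule k H) : Prop :=
  ∀ x ∈ V, Coalgebra.comul (R := k) x ∈
    LinearMap.range (TensorProduct.map V.subtype V.subtype)

/-- A Hopf algebra is pointed if every simple subcoalgebra is one-dimensional. -/
def IsPointedHopf : Prop :=
  ∀ V : Submodule k H, IsSubcoalgebra k H V → V ≠ ⊥ →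
    (∀ W : Submodule k H, W ≤ V → IsSubcoalgebra k H W → W = ⊥ ∨ W = V) →
    Module.finrank k ↥V = 1

/-- A coideal: `ε(X) = 0` and `Δ(X) ⊆ X ⊗ H + H ⊗ X`. -/
def IsCoideal (X : Submodule k H) : Prop :=
  (∀ x ∈ X, Coalgebra.counit (R := k) x = 0) ∧
  (∀ x ∈ X, Coalgebra.comul (R := k) x ∈
    LinearMap.range (TensorProduct.map X.subtype (LinearMap.id (M := H))) ⊔
    LinearMap.range (TensorProduct.map (LinearMap.id (M := H)) X.subtype))

/-- `S` is a Hopf subalgebra of the finite dual `H°` (with its convolution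
product; closure under the coproduct is expressed in pairing form). -/
def IsHopfSubalgSet (S : Set (Module.Dual k H)) : Prop :=
  S ⊆ finDual k H ∧ convOne k ∈ S ∧
  (∀ f g, f ∈ S → g ∈ S → f + g ∈ S ∧ conv k f g ∈ S) ∧
  (∀ (c : k), ∀ f ∈ S, c • f ∈ S) ∧
  (∀ f ∈ S, f ∘ₗ HopfAlgebra.antipode (R := k) ∈ S) ∧
  (∀ f ∈ S, ∃ (n : ℕ) (s t : Fin n → Module.Dual k H),
    (∀ i, s i ∈ S ∧ t i ∈ S) ∧ ∀ x y : H, f (x * y) = ∑ i, s i x * t i y)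

end Hopf

section Ext

variable (A : Type) [CommRing A] [HopfAlgebra k A]
variable (H : Type) [Ring H] [HopfAlgebra k H]

/-- The submodule `A⁺H` of `H` (image of the augmentation ideal times `H`). -/
def augHIdeal (ι : A →ₗ[k] H) : Submodule k H :=
  Submodule.span k
    {x : H | ∃ (a : A) (h : H), Coalgebra.counit (R := k) a = 0 ∧ x = ι a * h}

/-- The subset of the dual of `H` corresponding to `H̄* = (H/A⁺H)*`:
functionals vanishing on `A⁺H`. -/
def hbarStar (ι : A →ₗ[k] H) : Set (Module.Dual k H) :=
  {f | ∀ x ∈ augHIdeal k A H ι, f x = 0}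

/-- The tangential component `W(H°)`. -/
def tangential (ι : A →ₗ[k] H) : Set (Module.Dual k H) :=
  {f | f ∈ finDual k H ∧ ∃ n : ℕ, 0 < n ∧ ∀ x ∈ (augHIdeal k A H ι) ^ n, f x = 0}

/-- The augmentation ideal of the commutative Hopf algebra `A`. -/
def augIdeal : Ideal A := RingHom.ker (Bialgebra.counitAlgHom k A)

/-- The irreducible component `A'` of `A°` containing the counit:
functionals vanishing on a power of the augmentation ideal. -/
def Aprime : Set (Module.Dual k A) :=
  {f | ∃ n : ℕ, 0 < n ∧ ∀ x ∈ (augIdeal k A) ^ n, f x = 0}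

/-- The Lie algebra `𝔤` of `G_H`: primitive functionals on `A`. -/
def gLie : Set (Module.Dual k A) :=
  {f | f 1 = 0 ∧ ∀ x y : A, f (x * y) =
    f x * Coalgebra.counit (R := k) y + Coalgebra.counit (R := k) x * f y}

/-- An ideal of `A` is `H̄`-stable if it is stable under the (left) adjoint
action of `H` on `A` (which factors through `H̄`). -/
def IsHStable (ι : A →ₗ[k] H) (I : Ideal A) : Prop :=
  ∀ (h : H), ∀ a ∈ I, ∃ b ∈ I, ι b = adl k H h (ι a)

/-- `mc` is the `H̄`-core of `m`: the largest `H̄`-stable ideal of `A`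
contained in `m`. -/
def IsCore (ι : A →ₗ[k] H) (m mc : Ideal A) : Prop :=
  IsHStable k A H ι mc ∧ mc ≤ m ∧
    ∀ I : Ideal A, IsHStable k A H ι I → I ≤ m → I ≤ mc

/-- The submodule `H·J` of `H`, for an ideal `J` of `A`. -/
def leftMul (ι : A →ₗ[k] H) (J : Ideal A) : Submodule k H :=
  Submodule.span k {x : H | ∃ (h : H), ∃ a ∈ J, x = h * ι a}

/-- The submodule `J·H` of `H`, for an ideal `J` of `A`. -/
def rightMul (ι : A →ₗ[k] H) (J : Ideal A) : Submodule k H :=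
  Submodule.span k {x : H | ∃ (h : H), ∃ a ∈ J, x = ι a * h}

/-- The subcoalgebra `ĝ := (H/H m_g^{(H̄)})*` of `H°`, as a submodule of the dual. -/
def ghat (ι : A →ₗ[k] H) (core : Ideal A → Ideal A) (g : A →ₐ[k] k) :
    Submodule k (Module.Dual k H) :=
  (leftMul k A H ι (core (RingHom.ker g))).dualAnnihilator

/-- The character component `k̂G_H` of `H°`. -/
def charComp (ι : A →ₗ[k] H) (core : Ideal A → Ideal A) :
    Set (Module.Dual k H) :=
  {f | ∃ s : Finset (A →ₐ[k] k), s.Nonempty ∧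
    ∀ x ∈ ⨅ g ∈ s, leftMul k A H ι (core (RingHom.ker g)), f x = 0}

/-- Hypothesis (OrbSemi): all orbit algebras `A/m^{(H̄)}` are semisimple. -/
def OrbSemi (core : Ideal A → Ideal A) : Prop :=
  ∀ m : Ideal A, m.IsMaximal → IsSemisimpleRing (A ⧸ core m)

/-- Restriction of functionals along `ι` : the map `ι° : H° → A°`. -/
def iotaDual (ι : A →ₗ[k] H) (f : Module.Dual k H) : Module.Dual k A := f ∘ₗ ι

/-- Coextension of functionals along the projection `Π : H → A`:
the map `Π° : A° → H°`. -/
def PiDual (p : H →ₗ[k] A) (α : Module.Dual k A) : Module.Dual k H := α ∘ₗ p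

/-- `A ⊆ H` is an affine commutative-by-finite Hopf algebra, where the
inclusion of the commutative normal Hopf subalgebra `A` is recorded by the
injective Hopf algebra map `ι`. -/
structure CommByFinite (ι : A →ₗ[k] H) : Prop where
  ι_inj : Function.Injective ι
  ι_one : ι 1 = 1
  ι_mul : ∀ a b : A, ι (a * b) = ι a * ι b
  ι_comul : ∀ a : A,
    Coalgebra.comul (R := k) (ι a) = TensorProduct.map ι ι (Coalgebra.comul a)
  ι_counit : ∀ a : A,
    Coalgebra.counit (R := k) (ι a) = Coalgebra.counit (R := k) a
  ι_antipode : ∀ a : A,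
    ι (HopfAlgebra.antipode (R := k) a) = HopfAlgebra.antipode (R := k) (ι a)
  affine : ∃ s : Finset A, Algebra.adjoin k (s : Set A) = ⊤
  normal_left : ∀ (h : H) (a : A), adl k H h (ι a) ∈ Set.range ι
  normal_right : ∀ (h : H) (a : A), adr k H h (ι a) ∈ Set.range ι
  finiteOver : ∃ s : Finset H,
    Submodule.span k {x : H | ∃ (a : A), ∃ y ∈ s, x = ι a * y} = ⊤

/-- The standing hypothesis: `A` is semiprime (reduced) or central in `H`,
or `H` is pointed. -/
def StandingHyp (ι : A →ₗ[k] H) : Prop :=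
  IsReduced A ∨ (∀ (a : A) (h : H), ι a * h = h * ι a) ∨ IsPointedHopf k H

/-- `Π : H → A` is the projection of a direct sum decomposition
`H = A ⊕ X` of right `A`-modules. -/
structure IsSplitting (ι : A →ₗ[k] H) (p : H →ₗ[k] A) : Prop where
  left_inv : ∀ a : A, p (ι a) = a
  right_linear : ∀ (h : H) (a : A), p (h * ι a) = p h * a

/-- Hypothesis (CoSplit) for a given splitting `Π`: the complement
`X = ker Π` is a coideal of `H`. -/
def CoSplit (p : H →ₗ[k] A) : Prop := IsCoideal k H (LinearMap.ker p)

end Ext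

section Quot

variable (A : Type) [CommRing A] [HopfAlgebra k A]
variable (H : Type) [Ring H] [HopfAlgebra k H]
variable (Hb : Type) [Ring Hb] [HopfAlgebra k Hb]

/-- `π : H → H̄` realises `H̄` as the quotient Hopf algebra `H/A⁺H`. -/
structure IsHbarQuotient (ι : A →ₗ[k] H) (π : H →ₗ[k] Hb) : Prop where
  π_surj : Function.Surjective π
  π_one : π 1 = 1
  π_mul : ∀ x y : H, π (x * y) = π x * π y
  π_comul : ∀ x : H,
    Coalgebra.comul (R := k) (π x) = TensorProduct.map π π (Coalgebra.comul x)
  π_counit : ∀ x : H,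
    Coalgebra.counit (R := k) (π x) = Coalgebra.counit (R := k) x
  π_antipode : ∀ x : H,
    π (HopfAlgebra.antipode (R := k) x) = HopfAlgebra.antipode (R := k) (π x)
  π_ker : LinearMap.ker π = augHIdeal k A H ι
  findim : FiniteDimensional k Hb

/-- Composition with `π` : the map `π° : H̄* → H°`. -/
def piDual (π : H →ₗ[k] Hb) (β : Module.Dual k Hb) : Module.Dual k H := β ∘ₗ π

end Quot

end

end Paper

namespace PaperAux
open Paper

section
variable {k : Type} [Field k] {A : Type} [CommRing A] [HopfAlgebra k A]
  {H : Type} [Ring H] [HopfAlgebra k H] {ι : A →ₗ[k] H}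

/-- adjoint decomposition -/
lemma mul_eq_adl (h a : H) (r : Coalgebra.Repr k h (H × H)) :
    h * a = ∑ i ∈ r.index, adl k H (r.left i) a * r.right i := by
  let G : H ⊗[k] (H ⊗[k] H) →ₗ[k] H :=
    LinearMap.mul' k H ∘ₗ TensorProduct.map (LinearMap.mulRight k a)
      (LinearMap.mul' k H ∘ₗ (HopfAlgebra.antipode k).rTensor H)
  have e := congrArg G (Coalgebra.coassoc_apply (R := k) h)
  have r1 : G ((Coalgebra.comul (R := k)).lTensor H (Coalgebra.comul h)) = h * a := by
    rw [← r.eq]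
    simp only [map_sum, LinearMap.lTensor_tmul, G, LinearMap.comp_apply, TensorProduct.map_tmul,
      HopfAlgebra.mul_antipode_rTensor_comul_apply, LinearMap.mul'_apply, LinearMap.mulRight_apply]
    have e2 := congrArg (fun z => TensorProduct.rid k H z * a) (Coalgebra.sum_tmul_counit_eq r)
    simp only [map_sum, TensorProduct.rid_tmul, one_smul, Finset.sum_mul] at e2
    rw [← e2]
    refine Finset.sum_congr rfl fun i _ => ?_
    rw [Algebra.algebraMap_eq_smul_one, mul_smul_comm, mul_one, smul_mul_assoc]
  have r2 : G (TensorProduct.assoc k H H H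
      ((Coalgebra.comul (R := k)).rTensor H (Coalgebra.comul h))) =
      ∑ i ∈ r.index, adl k H (r.left i) a * r.right i := by
    conv_lhs => rw [← r.eq]
    simp only [map_sum, LinearMap.rTensor_tmul]
    refine Finset.sum_congr rfl fun i _ => ?_
    have q := ℛ k (r.left i)
    simp only [adl]
    rw [← q.eq]
    simp [TensorProduct.sum_tmul, Finset.sum_mul, G, mul_assoc]
  rw [← r1, ← r2, e]

lemma mul_eq_adr (h a : H) (r : Coalgebra.Repr k h (H × H)) :
    a * h = ∑ i ∈ r.index, r.left i * adr k H (r.right i) a := by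
  let G : H ⊗[k] (H ⊗[k] H) →ₗ[k] H :=
    LinearMap.mul' k H ∘ₗ (LinearMap.mul' k H ∘ₗ (LinearMap.mulRight k a ∘ₗ HopfAlgebra.antipode k).lTensor H).rTensor H
      ∘ₗ (TensorProduct.assoc k H H H).symm.toLinearMap
  have e := congrArg G (Coalgebra.coassoc_apply (R := k) h)
  have r1 : G (TensorProduct.assoc k H H H
      ((Coalgebra.comul (R := k)).rTensor H (Coalgebra.comul h))) = a * h := by
    have key : ∀ x : H, (LinearMap.mul' k H ∘ₗ (LinearMap.mulRight k a ∘ₗ HopfAlgebra.antipode k).lTensor H)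
        (Coalgebra.comul (R := k) x) = Coalgebra.counit (R := k) x • a := by
      intro x
      have := HopfAlgebra.mul_antipode_lTensor_comul_apply (R := k) x
      have h2 := congrArg (· * a) this
      have q := ℛ k x
      rw [← q.eq] at h2 ⊢
      simp [Finset.sum_mul, mul_assoc, Algebra.smul_def] at h2 ⊢
      exact h2
    rw [← r.eq]
    simp only [map_sum, LinearMap.rTensor_tmul, G, LinearMap.comp_apply,
      LinearEquiv.coe_coe, LinearEquiv.symm_apply_apply, LinearMap.mul'_apply] at key ⊢
    simp only [key]
    conv_rhs => rw [← Coalgebra.sum_counit_smul r]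
    simp [Finset.mul_sum]
  have r2 : G ((Coalgebra.comul (R := k)).lTensor H (Coalgebra.comul h)) =
      ∑ i ∈ r.index, r.left i * adr k H (r.right i) a := by
    conv_lhs => rw [← r.eq]
    simp only [map_sum, LinearMap.lTensor_tmul]
    refine Finset.sum_congr rfl fun i _ => ?_
    have q := ℛ k (r.right i)
    simp only [adr]
    rw [← q.eq]
    simp [TensorProduct.tmul_sum, Finset.mul_sum, G, mul_assoc]
  rw [← r1, ← r2, e]

lemma counit_adl (h a : H) (ha : Coalgebra.counit (R := k) a = 0) :
    Coalgebra.counit (R := k) (adl k H h a) = 0 := by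
  have q := ℛ k h
  simp only [adl]
  rw [← q.eq]
  simp [ha]

lemma counit_adr (h a : H) (ha : Coalgebra.counit (R := k) a = 0) :
    Coalgebra.counit (R := k) (adr k H h a) = 0 := by
  have q := ℛ k h
  simp only [adr]
  rw [← q.eq]
  simp [ha]

variable (k A) in
/-- powers of the augmentation ideal, as subspaces -/
def mI (n : ℕ) : Submodule k A := ((augIdeal k A) ^ n).restrictScalars k

variable (ι) in
def P (n : ℕ) : Submodule k H := (mI k A n).map ι

variable (ι) in
def K (n : ℕ) : Submodule k H := ⊤ * P ι n

lemma mem_mI {n : ℕ} {a : A} : a ∈ mI k A n ↔ a ∈ augIdeal k A ^ n := Iff.rfl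

lemma mem_mI_one {a : A} : a ∈ mI k A 1 ↔ Coalgebra.counit (R := k) a = 0 := by
  rw [mem_mI, pow_one]; rfl

lemma top_mul_top : (⊤ : Submodule k H) * ⊤ = ⊤ := by
  refine top_le_iff.1 fun x _ => ?_
  simpa using Submodule.mul_mem_mul (M := (⊤ : Submodule k H)) (N := ⊤) (m := x) (n := 1) trivial trivial

lemma mul_mem_P (hC : CommByFinite k A H ι) (a : A) {n : ℕ} {x : H} (hx : x ∈ P ι n) :
    ι a * x ∈ P ι n := by
  obtain ⟨b, hb, rfl⟩ := hx
  exact ⟨a * b, Ideal.mul_mem_left _ _ hb, hC.ι_mul _ _⟩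

lemma P_mul (hC : CommByFinite k A H ι) (m n : ℕ) : P ι m * P ι n = P ι (m + n) := by
  let φ : A →ₐ[k] H := AlgHom.ofLinearMap ι hC.ι_one hC.ι_mul
  have : ∀ n, P ι n = (mI k A n).map φ.toLinearMap := fun n => rfl
  rw [this, this, this, ← Submodule.map_mul]
  congr 1
  simp only [mI, pow_add]
  rfl

lemma comm_one (hC : CommByFinite k A H ι) : ⊤ * P ι 1 = P ι 1 * ⊤ := by
  apply le_antisymm
  · rw [Submodule.mul_le]
    rintro h - _ ⟨a, ha, rfl⟩
    rw [mul_eq_adl h (ι a) (ℛ k h)]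
    refine Submodule.sum_mem _ fun i _ => Submodule.mul_mem_mul ?_ trivial
    obtain ⟨b, hb⟩ := hC.normal_left ((ℛ k h).left i) a
    refine ⟨b, ?_, hb⟩
    apply mem_mI_one.2
    rw [← hC.ι_counit, hb]
    exact counit_adl _ _ ((hC.ι_counit a).trans (mem_mI_one.1 ha))
  · rw [Submodule.mul_le]
    rintro _ ⟨a, ha, rfl⟩ h -
    rw [mul_eq_adr h (ι a) (ℛ k h)]
    refine Submodule.sum_mem _ fun i _ => Submodule.mul_mem_mul trivial ?_
    obtain ⟨b, hb⟩ := hC.normal_right ((ℛ k h).right i) a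
    refine ⟨b, ?_, hb⟩
    apply mem_mI_one.2
    rw [← hC.ι_counit, hb]
    exact counit_adr _ _ ((hC.ι_counit a).trans (mem_mI_one.1 ha))

lemma one_mem_P0 (hC : CommByFinite k A H ι) : (1 : H) ∈ P ι 0 :=
  ⟨1, by rw [SetLike.mem_coe, mem_mI]; simp, hC.ι_one⟩

lemma K_zero (hC : CommByFinite k A H ι) : K ι 0 = ⊤ := by
  unfold K
  refine top_le_iff.1 fun x _ => ?_
  simpa using Submodule.mul_mem_mul (M := (⊤ : Submodule k H)) (m := x) trivial (one_mem_P0 hC)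

lemma comm (hC : CommByFinite k A H ι) (n : ℕ) : ⊤ * P ι n = P ι n * ⊤ := by
  induction n with
  | zero =>
    refine (K_zero hC).trans (top_le_iff.1 fun x _ => ?_).symm
    simpa using Submodule.mul_mem_mul (N := (⊤ : Submodule k H)) (n := x) (one_mem_P0 hC) trivial
  | succ n ih =>
    rw [← P_mul hC, ← mul_assoc, ih, mul_assoc, comm_one hC, mul_assoc]

lemma K_mul (hC : CommByFinite k A H ι) (m n : ℕ) : K ι m * K ι n = K ι (m + n) := by
  unfold K
  rw [comm hC m, mul_assoc, ← mul_assoc ⊤ ⊤, top_mul_top, comm hC n, ← mul_assoc, P_mul hC, comm hC]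

lemma K_succ_le (hC : CommByFinite k A H ι) (n : ℕ) : K ι (n + 1) ≤ K ι n := by
  refine mul_le_mul' le_rfl (Submodule.map_mono ?_)
  exact Ideal.pow_le_pow_right (Nat.le_succ n)

lemma K_antitone (hC : CommByFinite k A H ι) : Antitone (K ι) :=
  antitone_nat_of_succ_le (K_succ_le hC)

lemma augH_eq (hC : CommByFinite k A H ι) : augHIdeal k A H ι = K ι 1 := by
  unfold K
  rw [comm hC]
  apply le_antisymm
  · refine Submodule.span_le.2 ?_
    rintro _ ⟨a, h, ha, rfl⟩
    exact Submodule.mul_mem_mul ⟨a, mem_mI_one.2 ha, rfl⟩ trivial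
  · rw [Submodule.mul_le]
    rintro _ ⟨a, ha, rfl⟩ h -
    exact Submodule.subset_span ⟨a, h, mem_mI_one.1 ha, rfl⟩

lemma augH_pow (hC : CommByFinite k A H ι) (n : ℕ) : augHIdeal k A H ι ^ (n + 1) = K ι (n + 1) := by
  induction n with
  | zero => rw [zero_add, pow_one, augH_eq hC]
  | succ n ih => rw [pow_succ, ih, augH_eq hC, K_mul hC]

lemma K_left (hC : CommByFinite k A H ι) {n : ℕ} (h : H) {x : H} (hx : x ∈ K ι n) : h * x ∈ K ι n := by
  have := K_mul hC 0 n
  rw [zero_add, K_zero hC] at this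
  rw [← this]
  exact Submodule.mul_mem_mul trivial hx

lemma K_right (hC : CommByFinite k A H ι) {n : ℕ} (h : H) {x : H} (hx : x ∈ K ι n) : x * h ∈ K ι n := by
  have := K_mul hC n 0
  rw [add_zero, K_zero hC] at this
  rw [← this]
  exact Submodule.mul_mem_mul hx trivial

lemma antipode_K1 (hC : CommByFinite k A H ι) {x : H} (hx : x ∈ K ι 1) :
    HopfAlgebra.antipode k x ∈ K ι 1 := by
  revert x
  change K ι 1 ≤ (K ι 1).comap (HopfAlgebra.antipode k)
  conv_lhs => unfold K
  rw [Submodule.mul_le]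
  rintro h - _ ⟨a, ha, rfl⟩
  rw [Submodule.mem_comap, HopfAlgebra.antipode_mul_antidistrib, ← hC.ι_antipode]
  unfold K
  rw [comm hC]
  refine Submodule.mul_mem_mul ⟨_, mem_mI_one.2 ?_, rfl⟩ trivial
  rw [HopfAlgebra.counit_antipode]
  exact mem_mI_one.1 ha

lemma antipode_mul_K (hC : CommByFinite k A H ι) {x y : H} {n : ℕ} (hx : x ∈ K ι 1) (hy : y ∈ K ι n) :
    HopfAlgebra.antipode k x * y ∈ K ι (n + 1) := by
  rw [add_comm, ← K_mul hC]
  exact Submodule.mul_mem_mul (antipode_K1 hC hx) hy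


lemma mk_mul (hC : CommByFinite k A H ι) (h : H) (b : A) :
    (K ι 1).mkQ (h * ι b) = Coalgebra.counit (R := k) b • (K ι 1).mkQ h := by
  rw [← map_smul, ← sub_eq_zero, ← map_sub, Submodule.mkQ_apply, Submodule.Quotient.mk_eq_zero]
  have : h * ι b - Coalgebra.counit (R := k) b • h =
      h * ι (b - Coalgebra.counit (R := k) b • 1) := by
    rw [map_sub, map_smul, hC.ι_one, mul_sub, mul_smul_comm, mul_one]
  rw [this]
  refine Submodule.mul_mem_mul trivial ⟨_, mem_mI_one.2 ?_, rfl⟩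
  simp

lemma rho_mul (hC : CommByFinite k A H ι) (h : H) (a : A) :
    (K ι 1).mkQ.rTensor H (Coalgebra.comul (R := k) (h * ι a)) =
      (LinearMap.mulRight k (ι a)).lTensor _ ((K ι 1).mkQ.rTensor H (Coalgebra.comul (R := k) h)) := by
  have r := ℛ k h
  have q := ℛ k a
  have e : ι a = ∑ j ∈ q.index, Coalgebra.counit (R := k) (q.left j) • ι (q.right j) := by
    conv_lhs => rw [← Coalgebra.sum_counit_smul q]
    simp
  rw [Bialgebra.comul_mul, hC.ι_comul, ← r.eq, ← q.eq]
  simp only [map_sum, TensorProduct.map_tmul, Finset.sum_mul, Finset.mul_sum,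
    Algebra.TensorProduct.tmul_mul_tmul, LinearMap.rTensor_tmul, LinearMap.lTensor_tmul,
    mk_mul hC, LinearMap.mulRight_apply]
  rw [Finset.sum_comm]
  refine Finset.sum_congr rfl fun i _ => ?_
  rw [e, Finset.mul_sum, TensorProduct.tmul_sum]
  refine Finset.sum_congr rfl fun j _ => ?_
  rw [TensorProduct.smul_tmul, mul_smul_comm]

lemma conv_kills (hC : CommByFinite k A H ι) {n : ℕ} {t w : Module.Dual k H}
    (ht : ∀ x ∈ K ι 1, t x = 0) (hw : ∀ x ∈ K ι n, w x = 0) :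
    ∀ x ∈ K ι n, conv k t w x = 0 := by
  change K ι n ≤ LinearMap.ker (conv k t w)
  conv_lhs => unfold K
  rw [Submodule.mul_le]
  rintro h - _ ⟨a, ha, rfl⟩
  rw [LinearMap.mem_ker]
  have e : t = ((K ι 1).liftQ t ht) ∘ₗ (K ι 1).mkQ := (Submodule.liftQ_mkQ _ _ _).symm
  have e2 : conv k t w (h * ι a) = TensorProduct.lid k k (TensorProduct.map ((K ι 1).liftQ t ht) w
      ((K ι 1).mkQ.rTensor H (Coalgebra.comul (R := k) (h * ι a)))) := by
    conv_lhs => rw [e]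
    simp only [conv, LinearMap.comp_apply, LinearEquiv.coe_coe]
    congr 1
    exact (LinearMap.congr_fun (LinearMap.map_comp_rTensor _ _ _ _) _).symm
  rw [e2, rho_mul hC]
  have r := ℛ k h
  rw [← r.eq]
  simp only [map_sum, LinearMap.rTensor_tmul, LinearMap.lTensor_tmul, TensorProduct.map_tmul,
    LinearMap.mulRight_apply, TensorProduct.lid_tmul]
  refine Finset.sum_eq_zero fun i _ => ?_
  rw [hw (r.right i * ι a) (Submodule.mul_mem_mul trivial ⟨a, ha, rfl⟩), smul_zero]

lemma conv_iota (hC : CommByFinite k A H ι) {t w : Module.Dual k H}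
    (ht : ∀ x ∈ K ι 1, t x = 0) (ht1 : t 1 = 0) (a : A) : conv k t w (ι a) = 0 := by
  have key : ∀ b : A, t (ι b) = 0 := by
    intro b
    have h1 := mk_mul hC 1 b
    have h2 := congrArg ((K ι 1).liftQ t ht) h1
    rw [one_mul, map_smul] at h2
    change t (ι b) = _ • t 1 at h2
    rw [h2, ht1, smul_zero]
  simp only [conv, LinearMap.comp_apply, hC.ι_comul]
  have r := ℛ k a
  rw [← r.eq]
  simp [key]

/-- being coinvariant modulo `K n` -/
def Coinv (ι : A →ₗ[k] H) (n : ℕ) (h : H) : Prop :=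
  TensorProduct.map (K ι 1).mkQ (K ι n).mkQ (Coalgebra.comul (R := k) h) =
    (K ι 1).mkQ 1 ⊗ₜ (K ι n).mkQ h

lemma map_mk_mul (hC : CommByFinite k A H ι) (n : ℕ) (h : H) (a : A)
    (r : Coalgebra.Repr k h (H × H)) :
    TensorProduct.map (K ι 1).mkQ (K ι n).mkQ (Coalgebra.comul (R := k) (h * ι a)) =
      ∑ i ∈ r.index, (K ι 1).mkQ (r.left i) ⊗ₜ (K ι n).mkQ (r.right i * ι a) := by
  rw [← LinearMap.lTensor_comp_rTensor, LinearMap.comp_apply, rho_mul hC, ← r.eq]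
  simp only [map_sum, LinearMap.rTensor_tmul, LinearMap.lTensor_tmul, LinearMap.mulRight_apply]

lemma coinv_iota (hC : CommByFinite k A H ι) (n : ℕ) (a : A) : Coinv ι n (ι a) := by
  have h1 := rho_mul hC 1 a
  unfold Coinv
  rw [one_mul] at h1
  rw [← LinearMap.lTensor_comp_rTensor, LinearMap.comp_apply, h1, Bialgebra.comul_one,
    Algebra.TensorProduct.one_def]
  simp

lemma coinv_step (hC : CommByFinite k A H ι) (n : ℕ) (h : H) (hh : h ∈ K ι n)
    (hc : Coinv ι (n + 1) h) : ∃ a : A, h - ι a ∈ K ι (n + 1) := by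
  obtain ⟨p, hp⟩ := (K ι n).subtype.exists_leftInverse_of_injective (Submodule.ker_subtype _)
  have hp' : ∀ x (hx : x ∈ K ι n), ((p x : K ι n) : H) = x := fun x hx =>
    congrArg Subtype.val (LinearMap.congr_fun hp ⟨x, hx⟩)
  let B : H →ₗ[k] H →ₗ[k] (H ⧸ K ι (n + 1)) :=
    ((LinearMap.mul k H ∘ₗ HopfAlgebra.antipode k).compl₂ ((K ι n).subtype ∘ₗ p)).compr₂
      (K ι (n + 1)).mkQ
  have hB : ∀ x y, B x y = (K ι (n + 1)).mkQ (HopfAlgebra.antipode k x * (p y : H)) :=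
    fun x y => rfl
  have h1 : K ι 1 ≤ LinearMap.ker B := by
    intro x hx
    rw [LinearMap.mem_ker]
    ext y
    rw [hB]
    exact (Submodule.Quotient.mk_eq_zero _).2 (antipode_mul_K hC hx (p y).2)
  let B1 := (K ι 1).liftQ B h1
  have hB1 : ∀ x y, B1 ((K ι 1).mkQ x) y = B x y := fun x y => rfl
  have h2 : K ι (n + 1) ≤ LinearMap.ker B1.flip := by
    intro y hy
    rw [LinearMap.mem_ker]
    ext x
    change B x y = 0
    rw [hB, hp' y (K_succ_le hC n hy)]
    exact (Submodule.Quotient.mk_eq_zero _).2 (K_left hC _ hy)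
  let B2 := ((K ι (n + 1)).liftQ B1.flip h2).flip
  let M := TensorProduct.lift B2
  have hM : ∀ x y, M ((K ι 1).mkQ x ⊗ₜ (K ι (n + 1)).mkQ y) = B x y := fun x y => rfl
  have key : K ι n ≤ ((P ι n).map (K ι (n + 1)).mkQ).comap
      (M ∘ₗ TensorProduct.map (K ι 1).mkQ (K ι (n + 1)).mkQ ∘ₗ Coalgebra.comul (R := k)) := by
    conv_lhs => unfold K
    rw [Submodule.mul_le]
    rintro x - _ ⟨a, ha, rfl⟩
    rw [Submodule.mem_comap]
    simp only [LinearMap.comp_apply]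
    have r := ℛ k x
    rw [map_mk_mul hC _ x a r, map_sum]
    have : ∀ i ∈ r.index, M ((K ι 1).mkQ (r.left i) ⊗ₜ (K ι (n + 1)).mkQ (r.right i * ι a)) =
        (K ι (n + 1)).mkQ (HopfAlgebra.antipode k (r.left i) * r.right i * ι a) := by
      intro i _
      rw [hM, hB, hp' _ (Submodule.mul_mem_mul trivial ⟨a, ha, rfl⟩), mul_assoc]
    rw [Finset.sum_congr rfl this, ← map_sum, ← Finset.sum_mul,
      HopfAlgebra.sum_antipode_mul_eq_smul, smul_mul_assoc, one_mul, map_smul]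
    exact Submodule.smul_mem _ _ ⟨_, ⟨a, ha, rfl⟩, rfl⟩
  obtain ⟨_, ⟨a, ha, rfl⟩, e⟩ := key hh
  refine ⟨a, ?_⟩
  rw [LinearMap.comp_apply, LinearMap.comp_apply, hc, hM, hB, HopfAlgebra.antipode_one, one_mul,
    hp' h hh] at e
  rw [← Submodule.Quotient.mk_eq_zero]
  change (K ι (n + 1)).mkQ (h - ι a) = 0
  rw [map_sub, e, sub_self]

lemma coinv (hC : CommByFinite k A H ι) (n : ℕ) (h : H) (hc : Coinv ι n h) :
    ∃ a : A, h - ι a ∈ K ι n := by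
  induction n with
  | zero => exact ⟨0, by rw [K_zero hC]; trivial⟩
  | succ n ih =>
    have hc' : Coinv ι n h := by
      have e := congrArg ((Submodule.factor (K_succ_le hC n)).lTensor (H ⧸ K ι 1)) hc
      rw [← LinearMap.comp_apply, LinearMap.lTensor_comp_map, LinearMap.lTensor_tmul] at e
      exact e
    obtain ⟨a, ha⟩ := ih hc'
    have hc2 : Coinv ι (n + 1) (h - ι a) := by
      have := coinv_iota hC (n + 1) a
      unfold Coinv at *
      rw [map_sub, map_sub, hc, this, map_sub, TensorProduct.tmul_sub]
    obtain ⟨b, hb⟩ := coinv_step hC n _ ha hc2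
    exact ⟨a + b, by rwa [map_add, ← sub_sub]⟩


lemma noeth (hC : CommByFinite k A H ι) : IsNoetherianRing A := by
  obtain ⟨s, hs⟩ := hC.affine
  have : Algebra.FiniteType k A := ⟨⟨s, hs⟩⟩
  exact Algebra.FiniteType.isNoetherianRing k A

lemma cofin_A (hC : CommByFinite k A H ι) (n : ℕ) :
    ∃ V : Submodule k A, V.FG ∧ V ⊔ mI k A n = ⊤ := by
  have := noeth hC
  induction n with
  | zero => exact ⟨⊥, Submodule.fg_bot, by simp [mI, Ideal.one_eq_top]⟩
  | succ n ih =>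
    obtain ⟨V, hV, hV2⟩ := ih
    obtain ⟨s, hs⟩ := (IsNoetherian.noetherian (augIdeal k A ^ n))
    refine ⟨V ⊔ Submodule.span k (s : Set A), hV.sup ⟨s, rfl⟩, ?_⟩
    have key : ∀ y ∈ Submodule.span A (s : Set A), y ∈ Submodule.span k (s : Set A) ⊔ mI k A (n + 1) := by
      intro y hy
      induction hy using Submodule.span_induction with
      | mem x h => exact Submodule.mem_sup_left (Submodule.subset_span h)
      | zero => exact zero_mem _
      | add x y _ _ h1 h2 => exact add_mem h1 h2
      | smul a x hx h =>
        have : a • x = Coalgebra.counit (R := k) a • x + (a - Coalgebra.counit (R := k) a • 1) * x := by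
          rw [sub_mul, smul_mul_assoc, one_mul, smul_eq_mul]; ring
        rw [this]
        refine add_mem (Submodule.smul_mem _ _ h) (Submodule.mem_sup_right ?_)
        rw [mem_mI, pow_succ']
        refine Ideal.mul_mem_mul ?_ (hs ▸ hx)
        have := mem_mI_one (k := k) (a := a - Coalgebra.counit (R := k) a • (1 : A))
        rw [mem_mI, pow_one] at this
        exact this.2 (by simp)
    rw [sup_assoc, ← top_le_iff, ← hV2]
    refine sup_le_sup le_rfl ?_
    intro y hy
    exact key y (hs ▸ hy)

lemma findim (hC : CommByFinite k A H ι) (n : ℕ) : FiniteDimensional k (H ⧸ K ι n) := by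
  obtain ⟨V, hV, hV2⟩ := cofin_A hC n
  obtain ⟨s, hs⟩ := hC.finiteOver
  have hW : (V.map ι * Submodule.span k (s : Set H)).FG := (hV.map ι).mul ⟨s, rfl⟩
  have h2 : V.map ι * Submodule.span k (s : Set H) ⊔ K ι n = ⊤ := by
    rw [← top_le_iff, ← hs, Submodule.span_le]
    rintro _ ⟨a, y, hy, rfl⟩
    have ha : a ∈ V ⊔ mI k A n := hV2 ▸ trivial
    obtain ⟨v, hv, b, hb, rfl⟩ := Submodule.mem_sup.1 ha
    rw [map_add, add_mul]
    refine add_mem (Submodule.mem_sup_left (Submodule.mul_mem_mul ⟨v, hv, rfl⟩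
      (Submodule.subset_span hy))) (Submodule.mem_sup_right ?_)
    unfold K
    rw [comm hC]
    exact Submodule.mul_mem_mul ⟨b, hb, rfl⟩ trivial
  have h3 := congrArg (Submodule.map (K ι n).mkQ) h2
  rw [Submodule.map_sup, Submodule.map_top, Submodule.range_mkQ, Submodule.mkQ_map_self,
    sup_bot_eq] at h3
  exact ⟨h3 ▸ hW.map _⟩

lemma artin_rees (hC : CommByFinite k A H ι) (n : ℕ) :
    ∃ N : ℕ, 0 < N ∧ ∀ a : A, ι a ∈ K ι N → a ∈ augIdeal k A ^ n := by
  have := noeth hC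
  let φ : A →ₐ[k] H := AlgHom.ofLinearMap ι hC.ι_one hC.ι_mul
  letI : Module A H := Module.compHom H φ.toRingHom
  have hsm : ∀ (a : A) (h : H), a • h = ι a * h := fun _ _ => rfl
  have hfin : Module.Finite A H := by
    obtain ⟨s, hs⟩ := hC.finiteOver
    refine ⟨⟨s, ?_⟩⟩
    rw [← top_le_iff]
    intro x _
    have hx : x ∈ Submodule.span k {x : H | ∃ (a : A), ∃ y ∈ s, x = ι a * y} := hs ▸ trivial
    induction hx using Submodule.span_induction with
    | mem x h =>
      obtain ⟨a, y, hy, rfl⟩ := h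
      exact Submodule.smul_mem _ a (Submodule.subset_span hy)
    | zero => exact zero_mem _
    | add x y _ _ h1 h2 => exact add_mem (h1 trivial) (h2 trivial)
    | smul c x _ h =>
      have : c • x = (c • (1 : A)) • x := by
        rw [hsm, map_smul, hC.ι_one, smul_mul_assoc, one_mul]
      rw [this]
      exact Submodule.smul_mem _ _ (h trivial)
  let ψ : A →ₗ[A] H :=
    { toFun := ι
      map_add' := map_add ι
      map_smul' := fun a b => hC.ι_mul a b }
  obtain ⟨c, hc⟩ := Ideal.exists_pow_inf_eq_pow_smul (augIdeal k A) (LinearMap.range ψ)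
  refine ⟨n + c + 1, Nat.succ_pos _, fun a ha => ?_⟩
  have h1 : ι a ∈ (augIdeal k A ^ (n + c + 1) • ⊤ : Submodule A H) := by
    unfold K at ha
    rw [comm hC] at ha
    generalize ι a = x at ha
    induction ha using Submodule.mul_induction_on' with
    | mem_mul_mem x hx y hy =>
      obtain ⟨b, hb, rfl⟩ := hx
      exact Submodule.smul_mem_smul hb trivial
    | add x _ y _ h1 h2 => exact add_mem h1 h2
  have h2 : ι a ∈ (augIdeal k A ^ (n + 1) • LinearMap.range ψ : Submodule A H) := by
    have h3 : ι a ∈ (augIdeal k A ^ (n + c + 1) • ⊤ ⊓ LinearMap.range ψ : Submodule A H) :=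
      ⟨h1, ⟨a, rfl⟩⟩
    rw [hc _ (by omega), show n + c + 1 - c = n + 1 by omega] at h3
    exact Submodule.smul_mono le_rfl inf_le_right h3
  rw [LinearMap.range_eq_map, ← Submodule.map_smul''] at h2
  obtain ⟨b, hb, e⟩ := h2
  have := hC.ι_inj e
  subst this
  rw [smul_eq_mul, Ideal.mul_top] at hb
  exact Ideal.pow_le_pow_right (Nat.le_succ n) hb

lemma mem_finDual (hC : CommByFinite k A H ι) {f : Module.Dual k H} {n : ℕ}
    (hf : ∀ x ∈ K ι n, f x = 0) : f ∈ finDual k H :=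
  ⟨K ι n, fun h x hx => ⟨K_left hC h hx, K_right hC h hx⟩, fun x hx => hf x hx, findim hC n⟩

lemma mem_tangential (hC : CommByFinite k A H ι) {f : Module.Dual k H} :
    f ∈ tangential k A H ι ↔ ∃ n : ℕ, 0 < n ∧ ∀ x ∈ K ι n, f x = 0 := by
  constructor
  · rintro ⟨-, n, hn, h⟩
    obtain ⟨n, rfl⟩ := Nat.exists_eq_succ_of_ne_zero hn.ne'
    exact ⟨n + 1, hn, (augH_pow hC n) ▸ h⟩
  · rintro ⟨n, hn, h⟩
    refine ⟨mem_finDual hC h, n, hn, ?_⟩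
    obtain ⟨n, rfl⟩ := Nat.exists_eq_succ_of_ne_zero hn.ne'
    exact (augH_pow hC n).symm ▸ h

lemma tensor_sep {V W : Type} [AddCommGroup V] [Module k V] [AddCommGroup W] [Module k W]
    (x y : V ⊗[k] W)
    (h : ∀ (t : Module.Dual k V) (w : Module.Dual k W),
      TensorProduct.lid k k (TensorProduct.map t w x) = TensorProduct.lid k k (TensorProduct.map t w y)) :
    x = y := by
  let b := Module.Basis.ofVectorSpace k V
  let c := Module.Basis.ofVectorSpace k W
  have key : ∀ i j, ∀ z, (b.tensorProduct c).repr z (i, j) =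
      TensorProduct.lid k k (TensorProduct.map (b.coord i) (c.coord j) z) := by
    intro i j z
    induction z using TensorProduct.induction_on with
    | zero => simp
    | add x y h1 h2 => simp [h1, h2]
    | tmul x y => simp [mul_comm]
  apply (b.tensorProduct c).repr.injective
  ext ⟨i, j⟩
  rw [key, key, h]

lemma ker_le (hC : CommByFinite k A H ι) (f : Module.Dual k H) (n : ℕ) (hn : 0 < n)
    (hf : ∀ x ∈ K ι n, f x = 0) (hfA : ∀ a, f (ι a) = 0) :
    f ∈ Submodule.span k {x : Module.Dual k H | ∃ t w : Module.Dual k H,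
        t ∈ finDual k H ∩ hbarStar k A H ι ∧ t 1 = 0 ∧
        w ∈ tangential k A H ι ∧ x = conv k t w} := by
  let Φ : Submodule k (Module.Dual k H) := Submodule.span k
    {x | ∃ t w : Module.Dual k H, (∀ x ∈ K ι 1, t x = 0) ∧ t 1 = 0 ∧
      (∀ x ∈ K ι n, w x = 0) ∧ x = conv k t w}
  have hle : Φ ≤ Submodule.span k {x : Module.Dual k H | ∃ t w : Module.Dual k H,
        t ∈ finDual k H ∩ hbarStar k A H ι ∧ t 1 = 0 ∧
        w ∈ tangential k A H ι ∧ x = conv k t w} := by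
    refine Submodule.span_mono ?_
    rintro _ ⟨t, w, ht, ht1, hw, rfl⟩
    refine ⟨t, w, ⟨mem_finDual hC ht, ?_⟩, ht1, (mem_tangential hC).2 ⟨n, hn, hw⟩, rfl⟩
    intro x hx
    exact ht x (augH_eq hC ▸ hx)
  apply hle
  have hΦ : Φ ≤ (K ι n).dualAnnihilator := by
    refine Submodule.span_le.2 ?_
    rintro _ ⟨t, w, ht, ht1, hw, rfl⟩
    exact (Submodule.mem_dualAnnihilator _).2 (conv_kills hC ht hw)
  have := findim hC n
  have : FiniteDimensional k (K ι n).dualAnnihilator :=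
    Module.Finite.equiv (K ι n).dualQuotEquivDualAnnihilator
  have : FiniteDimensional k Φ := Submodule.finiteDimensional_of_le hΦ
  rw [← Subspace.dualCoannihilator_dualAnnihilator_eq (W := Φ)]
  rw [Submodule.mem_dualAnnihilator]
  intro h hh
  rw [Submodule.mem_dualCoannihilator] at hh
  have hc : Coinv ι n h := by
    apply tensor_sep
    intro t w
    let t' : Module.Dual k H := t ∘ₗ (K ι 1).mkQ
    let w' : Module.Dual k H := w ∘ₗ (K ι n).mkQ
    have kz : ∀ (m : ℕ) (x : H), x ∈ K ι m → (K ι m).mkQ x = 0 := fun m x hx =>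
      (Submodule.Quotient.mk_eq_zero _).2 hx
    have ht' : ∀ x ∈ K ι 1, t' x = 0 := fun x hx => by
      simp only [t', LinearMap.comp_apply, kz 1 x hx, map_zero]
    have hw' : ∀ x ∈ K ι n, w' x = 0 := fun x hx => by
      simp only [w', LinearMap.comp_apply, kz n x hx, map_zero]
    have hε : ∀ x ∈ K ι 1, Coalgebra.counit (R := k) x = 0 := by
      change K ι 1 ≤ LinearMap.ker (Coalgebra.counit (R := k))
      unfold K
      rw [Submodule.mul_le]
      rintro x - _ ⟨a, ha, rfl⟩
      rw [LinearMap.mem_ker, Bialgebra.counit_mul, hC.ι_counit, mem_mI_one.1 ha, mul_zero]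
    have e := hh (conv k (t' - t' 1 • Coalgebra.counit (R := k)) w') (Submodule.subset_span
      ⟨_, w', fun x hx => by simp [ht' x hx, hε x hx], by simp, hw', rfl⟩)
    have r := ℛ k h
    have e1 : (conv k (t' - t' 1 • Coalgebra.counit (R := k)) w') h =
        ∑ i ∈ r.index, t' (r.left i) * w' (r.right i) - t' 1 * w' h := by
      have e3 : w' h = ∑ i ∈ r.index, Coalgebra.counit (R := k) (r.left i) * w' (r.right i) := by
        have := congrArg w' (Coalgebra.sum_counit_smul r)
        simp only [map_sum, map_smul, smul_eq_mul] at this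
        exact this.symm
      rw [e3]
      simp only [conv, LinearMap.comp_apply]
      rw [← r.eq]
      simp [sub_mul, Finset.mul_sum, mul_assoc]
    rw [e1, sub_eq_zero] at e
    rw [← r.eq]
    simp only [map_sum, TensorProduct.map_tmul, TensorProduct.lid_tmul, smul_eq_mul]
    exact e
  obtain ⟨a, ha⟩ := coinv hC n h hc
  have := hf _ ha
  rwa [map_sub, hfA, sub_zero] at this

end
end PaperAux

open Paper in
/-- In characteristic `0`, the kernel of the restriction of
`ι°` to the tangential component equals `(H̄*)⁺ W(H°)`; combined with
`ι°(W(H°)) = A' = U(𝔤)` this gives `W(H°)/(H̄*)⁺W(H°) ≅ U(𝔤)`. -/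
theorem statement_9
    (k : Type) [Field k] [IsAlgClosed k] [CharZero k]
    (A : Type) [CommRing A] [HopfAlgebra k A]
    (H : Type) [Ring H] [HopfAlgebra k H]
    (ι : A →ₗ[k] H)
    (hCbF : CommByFinite k A H ι)
    (hyp : StandingHyp k A H ι)
    -- `S` is `(H̄*)⁺ W(H°)`
    (S : Submodule k (Module.Dual k H))
    (hS : S = Submodule.span k
      {x : Module.Dual k H | ∃ t w : Module.Dual k H,
        t ∈ finDual k H ∩ hbarStar k A H ι ∧ t 1 = 0 ∧
        w ∈ tangential k A H ι ∧ x = conv k t w}) :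
    -- `ker (ι°|_{W(H°)}) = (H̄*)⁺ W(H°)`
    {f ∈ tangential k A H ι | iotaDual k A H ι f = 0} = (S : Set (Module.Dual k H)) ∧
    -- and `ι°` maps `W(H°)` onto `A' = U(𝔤)`, so `W(H°)/(H̄*)⁺W(H°) ≅ U(𝔤)`
    iotaDual k A H ι '' tangential k A H ι = Aprime k A := by

  subst hS
  constructor
  · ext f
    constructor
    · rintro ⟨hf, hfA⟩
      obtain ⟨n, hn, h⟩ := (PaperAux.mem_tangential hCbF).1 hf
      exact PaperAux.ker_le hCbF f n hn h fun a => LinearMap.congr_fun hfA a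
    · intro hf
      have hf : f ∈ Submodule.span k _ := hf
      induction hf using Submodule.span_induction with
      | mem x h =>
        obtain ⟨t, w, ⟨-, ht⟩, ht1, hw, rfl⟩ := h
        have ht' : ∀ x ∈ PaperAux.K ι 1, t x = 0 := PaperAux.augH_eq hCbF ▸ ht
        obtain ⟨n, hn, h⟩ := (PaperAux.mem_tangential hCbF).1 hw
        refine ⟨(PaperAux.mem_tangential hCbF).2 ⟨n, hn, PaperAux.conv_kills hCbF ht' h⟩, ?_⟩
        exact LinearMap.ext fun a => PaperAux.conv_iota hCbF ht' ht1 a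
      | zero =>
        exact ⟨(PaperAux.mem_tangential hCbF).2 ⟨1, one_pos, fun _ _ => rfl⟩, rfl⟩
      | add x y _ _ h1 h2 =>
        have h1 := h1 ‹_›
        have h2 := h2 ‹_›
        obtain ⟨n, hn, hx⟩ := (PaperAux.mem_tangential hCbF).1 h1.1
        obtain ⟨m, hm, hy⟩ := (PaperAux.mem_tangential hCbF).1 h2.1
        refine ⟨(PaperAux.mem_tangential hCbF).2 ⟨n + m, by omega, fun z hz => ?_⟩, ?_⟩
        · rw [LinearMap.add_apply, hx z (PaperAux.K_antitone hCbF (Nat.le_add_right n m) hz),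
            hy z (PaperAux.K_antitone hCbF (Nat.le_add_left m n) hz), add_zero]
        · have e1 := h1.2
          have e2 := h2.2
          simp only [iotaDual] at e1 e2 ⊢
          rw [LinearMap.add_comp, e1, e2, add_zero]
      | smul c x _ h1 =>
        have h1 := h1 ‹_›
        obtain ⟨n, hn, hx⟩ := (PaperAux.mem_tangential hCbF).1 h1.1
        refine ⟨(PaperAux.mem_tangential hCbF).2 ⟨n, hn, fun z hz => ?_⟩, ?_⟩
        · rw [LinearMap.smul_apply, hx z hz, smul_zero]
        · have e1 := h1.2
          simp only [iotaDual] at e1 ⊢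
          rw [LinearMap.smul_comp, e1, smul_zero]
  · ext α
    constructor
    · rintro ⟨f, hf, rfl⟩
      obtain ⟨n, hn, h⟩ := (PaperAux.mem_tangential hCbF).1 hf
      refine ⟨n, hn, fun a ha => h _ ?_⟩
      have := Submodule.mul_mem_mul (M := (⊤ : Submodule k H)) (N := PaperAux.P ι n) (m := 1)
        trivial ⟨a, ha, rfl⟩
      rwa [one_mul] at this
    · rintro ⟨n, hn, h⟩
      obtain ⟨N, hN, hA⟩ := PaperAux.artin_rees hCbF n
      have h1 : α ∈ (LinearMap.ker ((PaperAux.K ι N).mkQ ∘ₗ ι)).dualAnnihilator := by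
        rw [Submodule.mem_dualAnnihilator]
        intro a ha
        refine h a (hA a ?_)
        rwa [LinearMap.mem_ker, LinearMap.comp_apply, Submodule.mkQ_apply,
          Submodule.Quotient.mk_eq_zero] at ha
      rw [← LinearMap.range_dualMap_eq_dualAnnihilator_ker] at h1
      obtain ⟨g, rfl⟩ := h1
      refine ⟨g ∘ₗ (PaperAux.K ι N).mkQ, (PaperAux.mem_tangential hCbF).2 ⟨N, hN, fun x hx => ?_⟩, rfl⟩
      rw [LinearMap.comp_apply, Submodule.mkQ_apply, (Submodule.Quotient.mk_eq_zero _).2 hx, map_zero]
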